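/- Classical bound for the two-body Bell inequality detecting Dicke states: for every n ≥ 2 and all functions m_0, m_1 : Fin n → {−1, +1}, writing S_0 = Σ_i m_0(i), S_1 = Σ_i m_1(i), S_00 = Σ_{i≠j} m_0(i)m_0(j), S_01 = Σ_{i≠j} m_0(i)m_1(j), S_11 = Σ_{i≠j} m_1(i)m_1(j) (sums over ordered pairs of distinct indices), and setting α_n = n(n−1)(⌈n/2⌉ − n/2), β_n = (n−1)(⌈n/2⌉ − n/2), γ_n = n(n−1)/2, δ_n = n/2, ε_n = −1, one has α_n·S_0 + β_n·S_1 + (γ_n/2)·S_00 + δ_n·S_01 + (ε_n/2)·S_11 ≥ −(1/2)·n·(n−1)·⌈(n+2)/2⌉. -/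

import Mathlib

/-- Symmetrized one-body correlator `S_k = ∑_i m_k(i)` of a deterministic local
strategy. -/
def oneBodySym (n : ℕ) (m : Fin n → ℤ) : ℝ := ∑ i, (m i : ℝ)

/-- Symmetrized two-body correlator `S_kl = ∑_{i≠j} m_k(i) m_l(j)` (sum over
ordered pairs of distinct indices) of a deterministic local strategy. -/
def twoBodySym (n : ℕ) (m m' : Fin n → ℤ) : ℝ :=
  ∑ i, ∑ j, if i = j then 0 else (m i : ℝ) * (m' j : ℝ)

/-- The two-body correlator is the product of the one-body correlators minus the diagonal. -/
lemma twoBodySym_eq (n : ℕ) (m m' : Fin n → ℤ) :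
    twoBodySym n m m' = ((∑ i, m i : ℤ) : ℝ) * ((∑ i, m' i : ℤ) : ℝ)
      - ((∑ i, m i * m' i : ℤ) : ℝ) := by
  have h : ∀ i j : Fin n, (if i = j then 0 else (m i : ℝ) * (m' j : ℝ))
      = (m i : ℝ) * (m' j : ℝ) - if i = j then (m i : ℝ) * (m' j : ℝ) else 0 := by
    intro i j
    split_ifs <;> simp
  simp only [twoBodySym, h, Finset.sum_sub_distrib, Finset.sum_ite_eq, Finset.mem_univ, if_true]
  push_cast
  rw [Finset.sum_mul_sum]

lemma sum_mul_self_of_sign {n : ℕ} {m : Fin n → ℤ} (hm : ∀ i, m i = 1 ∨ m i = -1) :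
    ∑ i, m i * m i = n := by
  have h : ∀ i, m i * m i = 1 := fun i => by rcases hm i with h | h <;> simp [h]
  simp [h]

lemma sum_le_of_forall_le_one {n : ℕ} {f : Fin n → ℤ} (hf : ∀ i, f i ≤ 1) :
    ∑ i, f i ≤ n := by
  simpa using Finset.sum_le_sum fun i (_ : i ∈ Finset.univ) => hf i

/-- The Bell functional is nonnegative, up to normalization, for an even number of parties. -/
lemma even_bell_nonneg {n x y z : ℤ} (hn : 2 ≤ n) (hx : Even x)
    (hy : y ≤ n) (hy' : -y ≤ n) (hz : z + (x - y) ≤ n) (hz' : z + (y - x) ≤ n) :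
    0 ≤ n * (n - 1) * x ^ 2 + 2 * n * (x * y) + 2 * n * (n - z) - 2 * y ^ 2 := by
  wlog hx0 : 0 ≤ x generalizing x y
  · have := this (x := -x) (y := -y) hx.neg (by linarith) (by linarith) (by linarith)
      (by linarith) (by linarith)
    linarith
  have hn0 : 0 ≤ n := by linarith
  obtain rfl | hx2 : x = 0 ∨ 2 ≤ x := by obtain ⟨k, rfl⟩ := hx; omega
  · rcases le_total 0 y with h | h
    · nlinarith [mul_le_mul_of_nonneg_left hz' hn0, mul_nonneg h (sub_nonneg.2 hy)]
    · nlinarith [mul_le_mul_of_nonneg_left hz hn0,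
        mul_nonneg (neg_nonneg.2 h) (sub_nonneg.2 hy')]
  · rcases le_total 0 y with h | h
    · have h1 : 0 ≤ n * (n - 1) * x ^ 2 :=
        mul_nonneg (mul_nonneg hn0 (by linarith)) (sq_nonneg x)
      have h2 : 0 ≤ n * y * (x - 1) := mul_nonneg (mul_nonneg hn0 h) (by linarith)
      have h3 : 0 ≤ n * (n - z) := mul_nonneg hn0 (by omega)
      nlinarith [mul_nonneg h (sub_nonneg.2 hy)]
    · have h1 : 0 ≤ (n - 1) * x + 2 + 2 * y := by nlinarith
      have h2 := mul_nonneg (mul_nonneg hn0 hx0) h1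
      nlinarith [mul_le_mul_of_nonneg_left hz hn0,
        mul_nonneg (neg_nonneg.2 h) (sub_nonneg.2 hy')]

/-- The Bell functional is nonnegative, up to normalization, for an odd number of parties;
here `u = S₀ + 1`. -/
lemma odd_bell_nonneg {n u y z : ℤ} (hn : 2 ≤ n) (hu : Even u)
    (hy : y ≤ n) (hy' : -y ≤ n) (hz : z + (u - 1 - y) ≤ n) (hz' : z + (y - (u - 1)) ≤ n) :
    0 ≤ n * (n - 1) * u ^ 2 + 2 * n * (n - z) - 2 * y + 2 * n * (u * y) - 2 * y ^ 2 := by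
  have hn0 : 0 ≤ n := by linarith
  have hnz : 0 ≤ n * (n - z) := mul_nonneg hn0 (by omega)
  have hsq : 0 ≤ n * (n - 1) * u ^ 2 := mul_nonneg (mul_nonneg hn0 (by linarith)) (sq_nonneg u)
  have e1 := mul_le_mul_of_nonneg_left hz hn0
  have e2 := mul_le_mul_of_nonneg_left hz' hn0
  obtain rfl | hu2 | hu2 : u = 0 ∨ 2 ≤ u ∨ u ≤ -2 := by obtain ⟨k, rfl⟩ := hu; omega
  · rcases le_or_gt 0 y with h | h
    · nlinarith [mul_nonneg (by linarith : 0 ≤ y + 1) (sub_nonneg.2 hy)]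
    · nlinarith [mul_nonneg (by linarith : 0 ≤ -(y + 1)) (sub_nonneg.2 hy')]
  · rcases le_or_gt 0 y with h | h
    · have h2 : 0 ≤ n * y * (u - 2) := mul_nonneg (mul_nonneg hn0 h) (by linarith)
      nlinarith [mul_nonneg h (sub_nonneg.2 hy), mul_nonneg h (sub_nonneg.2 hn)]
    · have h1 : 0 ≤ (n - 1) * (u - 2) := mul_nonneg (by linarith) (by linarith)
      have h2 := mul_nonneg (mul_nonneg hn0 (by linarith : 0 ≤ u)) h1
      have h3 : 0 ≤ (n * u - 1) * (n + y) := mul_nonneg (by nlinarith) (by linarith)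
      nlinarith [mul_nonneg (by linarith : 0 ≤ -y) (sub_nonneg.2 hy')]
  · rcases le_or_gt y 0 with h | h
    · have h2 : 0 ≤ n * (-y) * (-u - 1) :=
        mul_nonneg (mul_nonneg hn0 (by linarith)) (by linarith)
      nlinarith [mul_nonneg (by linarith : 0 ≤ -y) (sub_nonneg.2 hy')]
    · have h1 : 0 ≤ (n - 1) * (-u - 2) := mul_nonneg (by linarith) (by linarith)
      have h2 := mul_nonneg (mul_nonneg hn0 (by linarith : 0 ≤ -u)) h1
      have h3 : 0 ≤ n * (-u) * (n - y) :=
        mul_nonneg (mul_nonneg hn0 (by linarith)) (by linarith)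
      nlinarith [mul_nonneg h.le (sub_nonneg.2 hy)]

lemma even_sum_add_card_of_sign {n : ℕ} {m : Fin n → ℤ} (hm : ∀ i, m i = 1 ∨ m i = -1) :
    Even (∑ i, m i + n) := by
  have h : ∑ i, m i + n = ∑ i, (m i + 1) := by simp [Finset.sum_add_distrib]
  rw [h]
  exact Finset.even_sum _ fun i _ => by rcases hm i with h | h <;> simp [h]

/-- **Classical bound for the two-body Bell inequality detecting Dicke states**:
with `α_n = n(n−1)(⌈n/2⌉ − n/2)`, `β_n = (n−1)(⌈n/2⌉ − n/2)`, `γ_n = n(n−1)/2`,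
`δ_n = n/2`, `ε_n = −1`, every deterministic local strategy
`m₀, m₁ : Fin n → {−1,+1}` satisfies
`α_n S₀ + β_n S₁ + (γ_n/2) S₀₀ + δ_n S₀₁ + (ε_n/2) S₁₁ ≥ −(1/2)n(n−1)⌈(n+2)/2⌉`. -/
theorem classical_bound_dicke_bell_inequality (n : ℕ) (hn : 2 ≤ n)
    (m₀ m₁ : Fin n → ℤ)
    (hm₀ : ∀ i, m₀ i = 1 ∨ m₀ i = -1) (hm₁ : ∀ i, m₁ i = 1 ∨ m₁ i = -1) :
    ((n : ℝ) * ((n : ℝ) - 1) * ((⌈(n : ℝ) / 2⌉ : ℝ) - (n : ℝ) / 2)) * oneBodySym n m₀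
        + (((n : ℝ) - 1) * ((⌈(n : ℝ) / 2⌉ : ℝ) - (n : ℝ) / 2)) * oneBodySym n m₁
        + ((n : ℝ) * ((n : ℝ) - 1) / 2) / 2 * twoBodySym n m₀ m₀
        + ((n : ℝ) / 2) * twoBodySym n m₀ m₁
        + (-1 : ℝ) / 2 * twoBodySym n m₁ m₁
      ≥ -(1 / 2 * (n : ℝ) * ((n : ℝ) - 1) * (⌈((n : ℝ) + 2) / 2⌉ : ℝ)) := by
  have hy : ∑ i, m₁ i ≤ n := sum_le_of_forall_le_one fun i => by
    rcases hm₁ i with h | h <;> simp [h]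
  have hy' : -∑ i, m₁ i ≤ n := by
    rw [← Finset.sum_neg_distrib]
    exact sum_le_of_forall_le_one fun i => by rcases hm₁ i with h | h <;> simp [h]
  have hz : ∑ i, m₀ i * m₁ i + (∑ i, m₀ i - ∑ i, m₁ i) ≤ n := by
    rw [← Finset.sum_sub_distrib, ← Finset.sum_add_distrib]
    exact sum_le_of_forall_le_one fun i => by
      rcases hm₀ i with h | h <;> rcases hm₁ i with h' | h' <;> simp [h, h']
  have hz' : ∑ i, m₀ i * m₁ i + (∑ i, m₁ i - ∑ i, m₀ i) ≤ n := by
    rw [← Finset.sum_sub_distrib, ← Finset.sum_add_distrib]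
    exact sum_le_of_forall_le_one fun i => by
      rcases hm₀ i with h | h <;> rcases hm₁ i with h' | h' <;> simp [h, h']
  have hpar := even_sum_add_card_of_sign hm₀
  have hS (m : Fin n → ℤ) : oneBodySym n m = ((∑ i, m i : ℤ) : ℝ) := by simp [oneBodySym]
  rw [hS, hS, twoBodySym_eq, twoBodySym_eq, twoBodySym_eq, sum_mul_self_of_sign hm₀,
    sum_mul_self_of_sign hm₁]
  generalize ∑ i, m₀ i = x at *
  generalize ∑ i, m₁ i = y at *
  generalize ∑ i, m₀ i * m₁ i = z at *
  have hn' : (2 : ℤ) ≤ n := by exact_mod_cast hn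
  rcases Nat.even_or_odd' n with ⟨k, hk | hk⟩
  · have hnk : (n : ℝ) = 2 * k := by exact_mod_cast hk
    have c1 : ⌈(n : ℝ) / 2⌉ = k := by
      rw [Int.ceil_eq_iff]; push_cast; constructor <;> linarith
    have c2 : ⌈((n : ℝ) + 2) / 2⌉ = k + 1 := by
      rw [Int.ceil_eq_iff]; push_cast; constructor <;> linarith
    have hx : Even x := by
      obtain ⟨r, hr⟩ := hpar
      exact ⟨r - k, by omega⟩
    have key : (0 : ℝ) ≤ _ := Int.cast_nonneg (even_bell_nonneg hn' hx hy hy' hz hz')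
    rw [c1, c2]
    push_cast at key ⊢
    rw [hnk] at key ⊢
    linarith
  · have hnk : (n : ℝ) = 2 * k + 1 := by exact_mod_cast hk
    have c1 : ⌈(n : ℝ) / 2⌉ = k + 1 := by
      rw [Int.ceil_eq_iff]; push_cast; constructor <;> linarith
    have c2 : ⌈((n : ℝ) + 2) / 2⌉ = k + 2 := by
      rw [Int.ceil_eq_iff]; push_cast; constructor <;> linarith
    have hx : Even (x + 1) := by
      obtain ⟨r, hr⟩ := hpar
      exact ⟨r - k, by omega⟩
    have key : (0 : ℝ) ≤ _ := Int.cast_nonneg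
      (odd_bell_nonneg hn' hx hy hy' (by linarith : z + (x + 1 - 1 - y) ≤ n) (by linarith))
    rw [c1, c2]
    push_cast at key ⊢
    rw [hnk] at key ⊢
    linarith
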